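/- An ultrametric space M is homogeneous if and only if (1) Spec(M,x) = Spec(M,x') for all x, x' ∈ M, and (2) any two balls of M of the same kind are isometric as subspaces. -/

import Mathlib

open Metric

section Defs

variable {M : Type*} [MetricSpace M]

/-- The spectrum of a point `a`: the set of distances from `a` to points of the space. -/
def specAt (a : M) : Set ℝ := Set.range (dist a)

variable (M)

/-- The balls of `M`: open balls and closed balls of non-negative radius. -/
def ballsOf : Set (Set M) :=
  {B | ∃ (a : M) (r : ℝ), 0 ≤ r ∧ (B = ball a r ∨ B = closedBall a r)}

/-- A metric space is homogeneous if every isometry between two finite subsets of it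
extends to a surjective isometry of the whole space onto itself. -/
def IsHomogeneous : Prop :=
  ∀ F : Set M, F.Finite → ∀ φ : M → M,
    (∀ x ∈ F, ∀ y ∈ F, dist (φ x) (φ y) = dist x y) →
    ∃ ψ : M ≃ᵢ M, ∀ x ∈ F, ψ x = φ x

variable {M}

/-- The diameter of a set is attained. -/
def DiamAttained (B : Set M) : Prop := ∃ x ∈ B, ∃ y ∈ B, dist x y = Metric.diam B

/-- Two sets have the same kind if they have the same diameter, attained in both or in
none. -/
def SameKind (B B' : Set M) : Prop :=
  Metric.diam B = Metric.diam B' ∧ (DiamAttained B ↔ DiamAttained B')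

end Defs

section Ultrametric

variable {M : Type*} [MetricSpace M]

/-- Two subsets of a metric space are isometric, expressed with globally defined maps. -/
def IsometricSets (A B : Set M) : Prop :=
  ∃ f g : M → M, Set.MapsTo f A B ∧ Set.MapsTo g B A ∧ Set.InvOn g f A B ∧
    ∀ x ∈ A, ∀ y ∈ A, dist (f x) (f y) = dist x y

lemma IsometricSets.of_isometryEquiv {A B : Set M} (e : A ≃ᵢ B) : IsometricSets A B := by
  classical
  refine ⟨fun x => if h : x ∈ A then e ⟨x, h⟩ else x,
    fun x => if h : x ∈ B then e.symm ⟨x, h⟩ else x, ?_, ?_, ⟨?_, ?_⟩, ?_⟩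
  · intro x hx
    simp [hx]
  · intro x hx
    simp [hx]
  · intro x hx
    simp [hx]
  · intro x hx
    simp [hx]
  · intro x hx y hy
    simp only [hx, hy, dite_true]
    exact e.isometry.dist_eq ⟨x, hx⟩ ⟨y, hy⟩

lemma nonempty_isometryEquiv_of_image_eq (ψ : M ≃ᵢ M) {A B : Set M} (h : ψ '' A = B) :
    Nonempty (A ≃ᵢ B) := by
  subst h
  exact ⟨⟨ψ.toEquiv.image A, fun x y => ψ.isometry.edist_eq x y⟩⟩

lemma diam_le_of_dist_mem {A B : Set M} (hB : Bornology.IsBounded B)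
    (h : ∀ x ∈ A, ∀ y ∈ A, ∃ x' ∈ B, ∃ y' ∈ B, dist x' y' = dist x y) :
    diam A ≤ diam B := by
  refine diam_le_of_forall_dist_le diam_nonneg fun x hx y hy => ?_
  obtain ⟨x', hx', y', hy', hd⟩ := h x hx y hy
  exact hd ▸ dist_le_diam_of_mem hB hx' hy'

lemma sameKind_of_dist_mem {A B : Set M} (hA : Bornology.IsBounded A)
    (hB : Bornology.IsBounded B)
    (h : ∀ x ∈ A, ∀ y ∈ A, ∃ x' ∈ B, ∃ y' ∈ B, dist x' y' = dist x y)
    (h' : ∀ x ∈ B, ∀ y ∈ B, ∃ x' ∈ A, ∃ y' ∈ A, dist x' y' = dist x y) :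
    SameKind A B := by
  have hd : diam A = diam B := le_antisymm (diam_le_of_dist_mem hB h) (diam_le_of_dist_mem hA h')
  refine ⟨hd, ?_, ?_⟩
  · rintro ⟨x, hx, y, hy, hxy⟩
    obtain ⟨x', hx', y', hy', he⟩ := h x hx y hy
    exact ⟨x', hx', y', hy', by rw [he, hxy, hd]⟩
  · rintro ⟨x, hx, y, hy, hxy⟩
    obtain ⟨x', hx', y', hy', he⟩ := h' x hx y hy
    exact ⟨x', hx', y', hy', by rw [he, hxy, hd]⟩

lemma isBounded_of_mem_ballsOf {B : Set M} (hB : B ∈ ballsOf M) : Bornology.IsBounded B := by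
  obtain ⟨c, r, -, rfl | rfl⟩ := hB
  exacts [isBounded_ball, isBounded_closedBall]

variable [IsUltrametricDist M]

lemma dist_lt_of_lt_of_lt {x y z : M} {r : ℝ} (hx : dist x y < r) (hy : dist y z < r) :
    dist x z < r :=
  (dist_triangle_max x y z).trans_lt (max_lt hx hy)

lemma dist_le_of_le_of_le {x y z : M} {r : ℝ} (hx : dist x y ≤ r) (hy : dist y z ≤ r) :
    dist x z ≤ r :=
  (dist_triangle_max x y z).trans (max_le hx hy)

lemma dist_eq_of_dist_lt {x y z : M} (h : dist x y < dist y z) : dist x z = dist y z := by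
  apply le_antisymm
  · exact dist_le_of_le_of_le h.le le_rfl
  · by_contra! h'
    exact lt_irrefl _ (dist_lt_of_lt_of_lt (dist_comm x y ▸ h) h')

lemma sameKind_ball (hspec : ∀ x x' : M, specAt x = specAt x') (a b : M) (r : ℝ) :
    SameKind (ball a r) (ball b r) := by
  have key : ∀ a b : M, ∀ x ∈ ball a r, ∀ y ∈ ball a r,
      ∃ x' ∈ ball b r, ∃ y' ∈ ball b r, dist x' y' = dist x y := by
    intro a b x hx y hy
    have hxy : dist x y ∈ specAt b := hspec x b ▸ Set.mem_range_self y
    obtain ⟨z, hz⟩ := hxy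
    have hlt : dist x y < r := dist_lt_of_lt_of_lt hx (mem_ball'.1 hy)
    exact ⟨b, mem_ball_self (dist_nonneg.trans_lt hlt), z, mem_ball'.2 (hz ▸ hlt), hz⟩
  exact sameKind_of_dist_mem isBounded_ball isBounded_ball (key a b) (key b a)

lemma sameKind_closedBall (hspec : ∀ x x' : M, specAt x = specAt x') (a b : M) (r : ℝ) :
    SameKind (closedBall a r) (closedBall b r) := by
  have key : ∀ a b : M, ∀ x ∈ closedBall a r, ∀ y ∈ closedBall a r,
      ∃ x' ∈ closedBall b r, ∃ y' ∈ closedBall b r, dist x' y' = dist x y := by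
    intro a b x hx y hy
    have hxy : dist x y ∈ specAt b := hspec x b ▸ Set.mem_range_self y
    obtain ⟨z, hz⟩ := hxy
    have hle : dist x y ≤ r := dist_le_of_le_of_le hx (mem_closedBall'.1 hy)
    exact ⟨b, mem_closedBall_self (dist_nonneg.trans hle), z, mem_closedBall'.2 (hz ▸ hle), hz⟩
  exact sameKind_of_dist_mem isBounded_closedBall isBounded_closedBall (key a b) (key b a)

/-- Isometric open balls of radius `r` whose centers are at distance `r` can be exchanged by an
isometry of the whole space fixing every other point. -/
lemma exists_isometryEquiv_swap_balls {a b : M} {r : ℝ} (hab : dist a b = r) {f g : M → M}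
    (hf : Set.MapsTo f (ball a r) (ball b r)) (hg : Set.MapsTo g (ball b r) (ball a r))
    (hinv : Set.InvOn g f (ball a r) (ball b r))
    (hiso : ∀ x ∈ ball a r, ∀ y ∈ ball a r, dist (f x) (f y) = dist x y) :
    ∃ ψ : M ≃ᵢ M, (∀ x ∈ ball a r, ψ x = f x) ∧ (∀ x ∈ ball b r, ψ x = g x) ∧
      ∀ x, x ∉ ball a r → x ∉ ball b r → ψ x = x := by
  classical
  have hdisj : ∀ x ∈ ball a r, x ∉ ball b r := fun x hx hx' =>
    (dist_lt_of_lt_of_lt (mem_ball'.1 hx) hx').ne hab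
  have hdisj' : ∀ x ∈ ball b r, x ∉ ball a r := fun x hx hx' => hdisj x hx' hx
  let s : M → M := fun x => if x ∈ ball a r then f x else if x ∈ ball b r then g x else x
  have hsa : ∀ x ∈ ball a r, s x = f x := fun x hx => if_pos hx
  have hsb : ∀ x ∈ ball b r, s x = g x := fun x hx => by
    simp only [s, if_neg (hdisj' x hx), if_pos hx]
  have hsc : ∀ x, x ∉ ball a r → x ∉ ball b r → s x = x := fun x hx hx' => by
    simp only [s, if_neg hx, if_neg hx']
  have hss : ∀ x, s (s x) = x := by
    intro x
    by_cases hxa : x ∈ ball a r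
    · rw [hsa x hxa, hsb _ (hf hxa), hinv.1 hxa]
    by_cases hxb : x ∈ ball b r
    · rw [hsb x hxb, hsa _ (hg hxb), hinv.2 hxb]
    rw [hsc x hxa hxb, hsc x hxa hxb]
  have hcross : ∀ x ∈ ball a r, ∀ y ∈ ball b r, dist x y = r := by
    intro x hx y hy
    have hay : dist a y = r := by
      rw [dist_comm, dist_eq_of_dist_lt (y := b) (by rw [dist_comm b, hab]; exact hy),
        dist_comm, hab]
    rw [dist_eq_of_dist_lt (y := a) (by rw [hay]; exact hx), hay]
  have hout : ∀ x ∈ ball a r, ∀ y ∈ ball b r, ∀ z, z ∉ ball a r → z ∉ ball b r →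
      dist x z = dist y z := by
    intro x hx y hy z hza hzb
    rw [mem_ball', not_lt] at hza hzb
    rw [dist_eq_of_dist_lt (lt_of_lt_of_le (mem_ball.1 hx) hza),
      dist_eq_of_dist_lt (lt_of_lt_of_le (mem_ball.1 hy) hzb)]
    apply le_antisymm
    · exact dist_le_of_le_of_le (hab.trans_le hzb) le_rfl
    · exact dist_le_of_le_of_le ((dist_comm b a).trans_le (hab.trans_le hza)) le_rfl
  have hgiso : ∀ x ∈ ball b r, ∀ y ∈ ball b r, dist (g x) (g y) = dist x y := by
    intro x hx y hy
    rw [← hiso _ (hg hx) _ (hg hy), hinv.2 hx, hinv.2 hy]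
  have hsiso : Isometry s := by
    refine Isometry.of_dist_eq fun x y => ?_
    by_cases hxa : x ∈ ball a r
    · by_cases hya : y ∈ ball a r
      · rw [hsa x hxa, hsa y hya, hiso x hxa y hya]
      by_cases hyb : y ∈ ball b r
      · rw [hsa x hxa, hsb y hyb, dist_comm, hcross _ (hg hyb) _ (hf hxa), hcross x hxa y hyb]
      · rw [hsa x hxa, hsc y hya hyb, hout x hxa _ (hf hxa) y hya hyb]
    by_cases hxb : x ∈ ball b r
    · by_cases hya : y ∈ ball a r
      · rw [hsb x hxb, hsa y hya, hcross _ (hg hxb) _ (hf hya), dist_comm, hcross y hya x hxb]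
      by_cases hyb : y ∈ ball b r
      · rw [hsb x hxb, hsb y hyb, hgiso x hxb y hyb]
      · rw [hsb x hxb, hsc y hya hyb, hout _ (hg hxb) x hxb y hya hyb]
    rw [hsc x hxa hxb]
    by_cases hya : y ∈ ball a r
    · rw [hsa y hya, dist_comm, dist_comm x, hout y hya _ (hf hya) x hxa hxb]
    by_cases hyb : y ∈ ball b r
    · rw [hsb y hyb, dist_comm, dist_comm x, hout _ (hg hyb) y hyb x hxa hxb]
    · rw [hsc y hya hyb]
  exact ⟨IsometryEquiv.mk' s s hss hsiso, hsa, hsb, hsc⟩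

/-- Two points at distance at most `t` whose open `t`-balls are isometric admit an isometry of the
space taking the first of these balls onto the second and moving no point by more than `t`. -/
lemma exists_isometryEquiv_ball_to_ball {b c : M} {t : ℝ} (ht : 0 < t) (hbc : dist b c ≤ t)
    (h : IsometricSets (ball b t) (ball c t)) :
    ∃ ψ : M ≃ᵢ M, dist (ψ b) c < t ∧ ∀ x, dist (ψ x) x ≤ t := by
  rcases hbc.lt_or_eq with hlt | heq
  · exact ⟨IsometryEquiv.refl M, hlt, fun x => (dist_self x).trans_le ht.le⟩
  obtain ⟨f, g, hf, hg, hinv, hiso⟩ := h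
  obtain ⟨ψ, hb, hc, ho⟩ := exists_isometryEquiv_swap_balls heq hf hg hinv hiso
  refine ⟨ψ, ?_, fun x => ?_⟩
  · rw [hb b (mem_ball_self ht)]
    exact hf (mem_ball_self ht)
  by_cases hxb : x ∈ ball b t
  · rw [hb x hxb]
    exact dist_le_of_le_of_le (mem_ball.1 (hf hxb)).le
      (dist_le_of_le_of_le ((dist_comm c b).trans_le hbc) (mem_ball'.1 hxb).le)
  by_cases hxc : x ∈ ball c t
  · rw [hc x hxc]
    exact dist_le_of_le_of_le (mem_ball.1 (hg hxc)).le
      (dist_le_of_le_of_le hbc (mem_ball'.1 hxc).le)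
  · rw [ho x hxb hxc, dist_self]
    exact ht.le

lemma isometricSets_sphere (hspec : ∀ x x' : M, specAt x = specAt x')
    (hballs : ∀ B ∈ ballsOf M, ∀ B' ∈ ballsOf M, SameKind B B' → Nonempty (B ≃ᵢ B'))
    (a b : M) (t : ℝ) : IsometricSets (sphere a t) (sphere b t) := by
  rcases lt_trichotomy t 0 with ht | rfl | ht
  · rw [sphere_eq_empty_of_neg ht, sphere_eq_empty_of_neg ht]
    exact .of_isometryEquiv (IsometryEquiv.refl _)
  · refine ⟨fun _ => b, fun _ => a, ?_, ?_, ⟨?_, ?_⟩, ?_⟩ <;> simp [Set.MapsTo, Set.LeftInvOn,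
      Set.RightInvOn]
  obtain ⟨e⟩ := hballs _ ⟨a, t, ht.le, Or.inr rfl⟩ _ ⟨b, t, ht.le, Or.inr rfl⟩
    (sameKind_closedBall hspec a b t)
  obtain ⟨f, g, hf, hg, hinv, hiso⟩ := IsometricSets.of_isometryEquiv e
  have ha : a ∈ closedBall a t := mem_closedBall_self ht.le
  obtain ⟨e'⟩ := hballs _ ⟨f a, t, ht.le, Or.inl rfl⟩ _ ⟨b, t, ht.le, Or.inl rfl⟩
    (sameKind_ball hspec (f a) b t)
  obtain ⟨ψ, hψ, hmove⟩ := exists_isometryEquiv_ball_to_ball ht (hf ha) (.of_isometryEquiv e')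
  have hmove' : ∀ x, dist (ψ.symm x) x ≤ t := fun x => by
    simpa [dist_comm] using hmove (ψ.symm x)
  have hsc : ∀ x ∈ sphere a t, x ∈ closedBall a t := fun x hx => sphere_subset_closedBall hx
  have hback : ∀ y ∈ sphere b t, ψ.symm y ∈ closedBall b t := fun y hy =>
    dist_le_of_le_of_le (hmove' y) (mem_sphere.1 hy).le
  refine ⟨fun x => ψ (f x), fun y => g (ψ.symm y), ?_, ?_, ⟨?_, ?_⟩, ?_⟩
  · intro x hx
    have hd : dist (ψ (f a)) (ψ (f x)) = t := by
      rw [ψ.dist_eq, hiso a ha x (hsc x hx), dist_comm, hx]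
    rw [mem_sphere', dist_eq_of_dist_lt (y := ψ (f a)) (by rwa [hd, dist_comm]), hd]
  · intro y hy
    have hyb := hback y hy
    rw [mem_sphere, ← hiso _ (hg hyb) a ha, hinv.2 hyb, ← ψ.dist_eq, ψ.apply_symm_apply,
      dist_comm, dist_eq_of_dist_lt (y := b), dist_comm, hy]
    rwa [dist_comm b, hy]
  · intro x hx
    simp [hinv.1 (hsc x hx)]
  · intro y hy
    simp [hinv.2 (hback y hy)]
  · intro x hx y hy
    rw [ψ.dist_eq, hiso x (hsc x hx) y (hsc y hy)]

/-- If corresponding spheres around two points are isometric, some isometry of the space takes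
one point to the other. -/
lemma exists_isometryEquiv_apply_eq {a b : M}
    (h : ∀ t, IsometricSets (sphere a t) (sphere b t)) : ∃ ψ : M ≃ᵢ M, ψ a = b := by
  choose f g hf hg hinv hiso using h
  have hf' : ∀ x, dist (f (dist x a) x) b = dist x a := fun x => hf _ (mem_sphere.2 rfl)
  have hg' : ∀ x, dist (g (dist x b) x) a = dist x b := fun x => hg _ (mem_sphere.2 rfl)
  have hlt : ∀ x y, dist x a < dist y a →
      dist (f (dist x a) x) (f (dist y a) y) = dist x y := by
    intro x y hxy
    rw [dist_eq_of_dist_lt (y := b) (by rwa [hf', dist_comm b, hf']), dist_comm, hf',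
      dist_eq_of_dist_lt (x := x) (y := a) (by rwa [dist_comm a]), dist_comm]
  have hf_iso : Isometry fun x => f (dist x a) x := by
    refine Isometry.of_dist_eq fun x y => ?_
    rcases lt_trichotomy (dist x a) (dist y a) with h | h | h
    · exact hlt x y h
    · simp only [h]
      exact hiso _ x h y rfl
    · rw [dist_comm, hlt y x h, dist_comm]
  refine ⟨IsometryEquiv.mk' (fun x => f (dist x a) x) (fun y => g (dist y b) y) (fun y => ?_)
    hf_iso, ?_⟩
  · rw [hg']
    exact (hinv _).2 (mem_sphere.2 rfl)
  · change f (dist a a) a = b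
    rw [← dist_eq_zero, hf', dist_self]

/-- Isometries of a point-transitive ultrametric space extend from finite sets. -/
lemma isHomogeneous_of_transitive (h : ∀ a b : M, ∃ ψ : M ≃ᵢ M, ψ a = b) :
    IsHomogeneous M := by
  intro F hF
  induction F, hF using Set.Finite.induction_on with
  | empty => exact fun φ _ => ⟨IsometryEquiv.refl M, by simp⟩
  | @insert a F _ _ ih =>
    intro φ hφ
    obtain ⟨ψ, hψ⟩ := ih φ fun x hx y hy => hφ x (Or.inr hx) y (Or.inr hy)
    by_cases hne : ψ a = φ a
    · refine ⟨ψ, ?_⟩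
      rintro x (rfl | hx)
      exacts [hne, hψ x hx]
    obtain ⟨τ, hτ⟩ := h (ψ a) (φ a)
    set r := dist (ψ a) (φ a) with hr
    have hrpos : 0 < r := dist_pos.2 hne
    have hball : ∀ x, x ∈ ball (ψ a) r ↔ τ x ∈ ball (φ a) r := fun x => by
      rw [mem_ball, mem_ball, ← hτ, τ.dist_eq]
    obtain ⟨σ, hσa, -, hσ⟩ := exists_isometryEquiv_swap_balls hr.symm
      (f := τ) (g := τ.symm) (fun x hx => (hball x).1 hx)
      (fun x hx => (hball _).2 (by rwa [τ.apply_symm_apply]))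
      ⟨fun x _ => τ.symm_apply_apply x, fun x _ => τ.apply_symm_apply x⟩
      (fun x _ y _ => τ.dist_eq x y)
    refine ⟨ψ.trans σ, ?_⟩
    rintro x (rfl | hx)
    · rw [IsometryEquiv.trans_apply, hσa _ (mem_ball_self hrpos), hτ]
    have hd : dist (φ a) (φ x) = dist (ψ a) (φ x) := by
      rw [hφ a (Or.inl rfl) x (Or.inr hx), ← hψ x hx, ψ.dist_eq]
    have hle : r ≤ dist (ψ a) (φ x) := by
      by_contra! hlt
      exact lt_irrefl r (dist_lt_of_lt_of_lt hlt (by rwa [dist_comm, hd]))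
    rw [IsometryEquiv.trans_apply, hψ x hx]
    apply hσ
    · rw [mem_ball', not_lt]
      exact hle
    · rw [mem_ball', hd, not_lt]
      exact hle

lemma eq_closedBall_of_diamAttained {B : Set M} (hB : B ∈ ballsOf M) {a : M} (ha : a ∈ B)
    (hatt : DiamAttained B) : B = closedBall a (diam B) := by
  apply Set.Subset.antisymm
  · exact fun x hx => dist_le_diam_of_mem (isBounded_of_mem_ballsOf hB) hx ha
  obtain ⟨x, hx, y, hy, hxy⟩ := hatt
  rw [← hxy]
  intro z hz
  obtain ⟨c, r, -, rfl | rfl⟩ := hB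
  · exact dist_lt_of_lt_of_lt
      ((mem_closedBall.1 hz).trans_lt (dist_lt_of_lt_of_lt hx (mem_ball'.1 hy))) ha
  · exact dist_le_of_le_of_le
      ((mem_closedBall.1 hz).trans (dist_le_of_le_of_le hx (mem_closedBall'.1 hy))) ha

lemma eq_ball_of_not_diamAttained {B : Set M} (hB : B ∈ ballsOf M) {a : M} (ha : a ∈ B)
    (hatt : ¬ DiamAttained B) : B = ball a (diam B) := by
  apply Set.Subset.antisymm
  · exact fun x hx => (dist_le_diam_of_mem (isBounded_of_mem_ballsOf hB) hx ha).lt_of_ne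
      fun h => hatt ⟨x, hx, a, ha, h⟩
  intro z hz
  obtain ⟨c, r, hr, rfl | rfl⟩ := hB
  · have hd : diam (ball c r) ≤ r := diam_le_of_forall_dist_le hr fun x hx y hy =>
      (dist_lt_of_lt_of_lt hx (mem_ball'.1 hy)).le
    exact dist_lt_of_lt_of_lt ((mem_ball.1 hz).trans_le hd) ha
  · have hd : diam (closedBall c r) ≤ r := diam_le_of_forall_dist_le hr fun x hx y hy =>
      dist_le_of_le_of_le hx (mem_closedBall'.1 hy)
    exact dist_le_of_le_of_le ((mem_ball.1 hz).le.trans hd) ha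

lemma nonempty_isometryEquiv_of_sameKind (h : ∀ a b : M, ∃ ψ : M ≃ᵢ M, ψ a = b)
    {B B' : Set M} (hB : B ∈ ballsOf M) (hB' : B' ∈ ballsOf M) (hk : SameKind B B') :
    Nonempty (B ≃ᵢ B') := by
  obtain ⟨hd, hatt⟩ := hk
  have empty_iff : ∀ A : Set M, A = ∅ ↔ diam A = 0 ∧ ¬ DiamAttained A := by
    intro A
    constructor
    · rintro rfl
      simp [DiamAttained]
    · rintro ⟨h0, hna⟩
      by_contra hne
      obtain ⟨x, hx⟩ := Set.nonempty_iff_ne_empty.2 hne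
      exact hna ⟨x, hx, x, hx, by rw [h0, dist_self]⟩
  have hempty : B = ∅ ↔ B' = ∅ := by rw [empty_iff, empty_iff, hd, hatt]
  rcases B.eq_empty_or_nonempty with hBe | ⟨a, ha⟩
  · rw [hempty.1 hBe, hBe]
    exact ⟨IsometryEquiv.refl _⟩
  have hne : B ≠ ∅ := Set.nonempty_iff_ne_empty.1 ⟨a, ha⟩
  obtain ⟨b, hb⟩ := Set.nonempty_iff_ne_empty.2 fun hB'e => hne (hempty.2 hB'e)
  obtain ⟨ψ, hψ⟩ := h a b
  apply nonempty_isometryEquiv_of_image_eq ψ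
  by_cases hA : DiamAttained B
  · rw [eq_closedBall_of_diamAttained hB ha hA,
      eq_closedBall_of_diamAttained hB' hb (hatt.1 hA), ψ.image_closedBall, hψ, hd]
  · rw [eq_ball_of_not_diamAttained hB ha hA,
      eq_ball_of_not_diamAttained hB' hb (fun h' => hA (hatt.2 h')), ψ.image_ball, hψ, hd]

end Ultrametric

/-- An ultrametric space `M` is homogeneous if and only if (1) all
points of `M` have the same spectrum, and (2) any two balls of `M` of the same kind are
isometric as subspaces. -/
theorem stmt16 {M : Type*} [MetricSpace M]
    (ultra : ∀ x y z : M, dist x z ≤ max (dist x y) (dist y z)) :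
    IsHomogeneous M ↔
      (∀ x x' : M, specAt x = specAt x') ∧
        (∀ B ∈ ballsOf M, ∀ B' ∈ ballsOf M, SameKind B B' → Nonempty (B ≃ᵢ B')) := by
  have : IsUltrametricDist M := ⟨ultra⟩
  constructor
  · intro hom
    have trans : ∀ a b : M, ∃ ψ : M ≃ᵢ M, ψ a = b := by
      intro a b
      obtain ⟨ψ, hψ⟩ := hom {a} (Set.finite_singleton a) (fun _ => b) (by simp)
      exact ⟨ψ, hψ a rfl⟩
    refine ⟨fun x x' => ?_, fun B hB B' hB' => nonempty_isometryEquiv_of_sameKind trans hB hB'⟩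
    obtain ⟨ψ, rfl⟩ := trans x x'
    rw [specAt, specAt, ← ψ.surjective.range_comp (dist (ψ x))]
    congr 1
    ext y
    exact (ψ.dist_eq x y).symm
  · rintro ⟨hspec, hballs⟩
    exact isHomogeneous_of_transitive fun a b =>
      exists_isometryEquiv_apply_eq (isometricSets_sphere hspec hballs a b)
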